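/- arXiv:2108.03652 — 9 statements merged into one kernel-verified Lean document; each statement's English description precedes it below -/
import Mathlib

section
/- For any coercive operator T : G → G (note that coercivity makes T invertible), one has the internal direct sum decompositions G = X ⊕ T⁻¹(X^⊥) and G = X^⊥ ⊕ T(X), where T⁻¹(X^⊥) denotes the preimage of X^⊥ under T and T(X) the image of X under T. Moreover, if T = T†, then the first direct sum is T-orthogonal (⟨T x, y⟩ = 0 for all x ∈ X and y ∈ T⁻¹(X^⊥)) and the second is T⁻¹-orthogonal (⟨T⁻¹ p, q⟩ = 0 for all p ∈ X^⊥ and q ∈ T(X)). -/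
open LinearMap (adjoint)
open scoped ComplexInnerProductSpace

noncomputable section

/-- A coercive operator is injective. -/
theorem ker_eq_bot_of_coercive
    {G : Type*} [NormedAddCommGroup G] [InnerProductSpace ℂ G]
    {T : G →ₗ[ℂ] G}
    (hT : ∀ v : G, v ≠ 0 → 0 < (⟪v, T v⟫).re) : LinearMap.ker T = ⊥ := by
  refine LinearMap.ker_eq_bot'.2 fun v hv => ?_
  by_contra h
  simpa [hv] using hT v h

/-- A subspace meets the preimage of its orthogonal complement under a coercive operator
trivially. -/
theorem disjoint_comap_orthogonal_of_coercive
    {G : Type*} [NormedAddCommGroup G] [InnerProductSpace ℂ G]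
    {T : G →ₗ[ℂ] G}
    (hT : ∀ v : G, v ≠ 0 → 0 < (⟪v, T v⟫).re) (K : Submodule ℂ G) :
    Disjoint K (Kᗮ.comap T) := by
  refine Submodule.disjoint_def.2 fun v hv hTv => ?_
  by_contra h
  have h0 : ⟪v, T v⟫ = 0 := hTv v hv
  simpa [h0] using hT v h

variable {G H : Type*}
  [NormedAddCommGroup G] [InnerProductSpace ℂ G] [FiniteDimensional ℂ G]
  [NormedAddCommGroup H] [InnerProductSpace ℂ H] [FiniteDimensional ℂ H]

theorem isCompl_orthogonal_map_of_coercive {T : G →ₗ[ℂ] G}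
    (hT : ∀ v : G, v ≠ 0 → 0 < (⟪v, T v⟫).re) (K : Submodule ℂ G) :
    IsCompl Kᗮ (K.map T) := by
  have hdisj : Disjoint Kᗮ (K.map T) := by
    refine Submodule.disjoint_def.2 ?_
    rintro _ hp ⟨x, hx, rfl⟩
    rw [Submodule.disjoint_def.1 (disjoint_comap_orthogonal_of_coercive hT K) x hx hp, map_zero]
  refine (Submodule.isCompl_iff_disjoint _ _ ?_).2 hdisj
  rw [← (K.equivMapOfInjective T
    (LinearMap.ker_eq_bot.1 (ker_eq_bot_of_coercive hT))).finrank_eq, add_comm,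
    K.finrank_add_finrank_orthogonal]

theorem isCompl_comap_orthogonal_of_coercive {T : G →ₗ[ℂ] G}
    (hT : ∀ v : G, v ≠ 0 → 0 < (⟪v, T v⟫).re) (K : Submodule ℂ G) :
    IsCompl K (Kᗮ.comap T) := by
  refine ⟨disjoint_comap_orthogonal_of_coercive hT K, Submodule.codisjoint_iff_exists_add_eq.2 ?_⟩
  intro g
  obtain ⟨p, _, hp, ⟨x, hx, rfl⟩, h⟩ := Submodule.codisjoint_iff_exists_add_eq.1
    (isCompl_orthogonal_map_of_coercive hT K).codisjoint (T g)
  refine ⟨x, g - x, hx, ?_, by abel⟩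
  rwa [Submodule.mem_comap, map_sub, ← h, add_sub_cancel_right]

/-- For any coercive operator `T : G → G`, one has the internal direct sum decompositions
`G = X ⊕ T⁻¹(X^⊥)` and `G = X^⊥ ⊕ T(X)`; moreover if `T = T†` the first direct sum is
`T`-orthogonal and the second is `T⁻¹`-orthogonal.  Here `X := range R` and the paper's
pairing `⟨p, v⟩` (linear in the first argument) is `⟪v, p⟫` in Mathlib's convention. -/
theorem statement0
    (R : H →ₗ[ℂ] G) (hR : Function.Injective R)
    (T : G →ₗ[ℂ] G) (hT : ∀ v : G, v ≠ 0 → 0 < (⟪v, T v⟫).re) :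
    (IsCompl (LinearMap.range R) ((LinearMap.range R)ᗮ.comap T) ∧
      IsCompl (LinearMap.range R)ᗮ ((LinearMap.range R).map T)) ∧
    (adjoint T = T →
      (∀ x ∈ LinearMap.range R, ∀ y ∈ (LinearMap.range R)ᗮ.comap T,
          ⟪y, T x⟫ = 0) ∧
      (∀ p ∈ (LinearMap.range R)ᗮ, ∀ q ∈ (LinearMap.range R).map T,
          ⟪q, Ring.inverse T p⟫ = 0)) := by
  refine ⟨⟨isCompl_comap_orthogonal_of_coercive hT _,
    isCompl_orthogonal_map_of_coercive hT _⟩, fun hadj => ?_⟩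
  have hsymm : ∀ x y : G, ⟪T x, y⟫ = ⟪x, T y⟫ := fun x y => by
    conv_lhs => rw [← hadj, LinearMap.adjoint_inner_left]
  refine ⟨fun x hx y hy => ?_, ?_⟩
  · rw [← hsymm]
    exact Submodule.inner_left_of_mem_orthogonal hx hy
  · rintro p hp _ ⟨x, hx, rfl⟩
    have hunit : IsUnit T := (LinearMap.isUnit_iff_ker_eq_bot T).2 (ker_eq_bot_of_coercive hT)
    have hinv : T (Ring.inverse T p) = p := by
      rw [← Module.End.mul_apply, Ring.mul_inverse_cancel T hunit, Module.End.one_apply]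
    rw [hsymm, hinv]
    exact hp x hx
end
end

section
/- Let T : G → G be coercive. Then R† T† R : H → H is invertible, and the exchange operator Π := (T + T†) R (R† T† R)⁻¹ R† − Id : G → G is an isometry for the Ts⁻¹-norm: ‖Π p‖_{Ts⁻¹} = ‖p‖_{Ts⁻¹} for every p ∈ G. -/
open LinearMap (adjoint)
open scoped ComplexInnerProductSpace

noncomputable section

variable {G H : Type*}
  [NormedAddCommGroup G] [InnerProductSpace ℂ G] [FiniteDimensional ℂ G]
  [NormedAddCommGroup H] [InnerProductSpace ℂ H] [FiniteDimensional ℂ H]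

/-- The symmetric part `Ts := (T + T†)/2` of an operator. -/
def Ts (T : G →ₗ[ℂ] G) : G →ₗ[ℂ] G := (2⁻¹ : ℂ) • (T + adjoint T)

/-- The norm `‖p‖_{Ts⁻¹}`, i.e. `√⟨Ts⁻¹ p, p⟩` with the paper's pairing,
which reads `√⟪p, Ts⁻¹ p⟫` in Mathlib's convention. -/
def normTsInv (T : G →ₗ[ℂ] G) (p : G) : ℝ :=
  Real.sqrt (⟪p, Ring.inverse (Ts T) p⟫).re

/-- The exchange operator `Π := (T + T†) R (R† T† R)⁻¹ R† − Id`. -/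
def exchangeOp (R : H →ₗ[ℂ] G) (T : G →ₗ[ℂ] G) : G →ₗ[ℂ] G :=
  (T + adjoint T) ∘ₗ R ∘ₗ Ring.inverse (adjoint R ∘ₗ adjoint T ∘ₗ R) ∘ₗ adjoint R
    - LinearMap.id

/-- An endomorphism of a finite-dimensional complex inner product space whose quadratic form
has positive real part away from the origin is invertible. -/
lemma isUnit_of_re_inner_pos {A : G →ₗ[ℂ] G} (hA : ∀ v : G, v ≠ 0 → 0 < (⟪v, A v⟫).re) :
    IsUnit A := by
  rw [LinearMap.isUnit_iff_ker_eq_bot, LinearMap.ker_eq_bot']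
  intro v hv
  by_contra hne
  simpa [hv] using hA v hne

lemma re_inner_adjoint_self (T : G →ₗ[ℂ] G) (v : G) :
    (⟪v, adjoint T v⟫).re = (⟪v, T v⟫).re := by
  rw [LinearMap.adjoint_inner_right, ← inner_conj_symm, Complex.conj_re]

lemma re_inner_Ts_self (T : G →ₗ[ℂ] G) (v : G) : (⟪v, Ts T v⟫).re = (⟪v, T v⟫).re := by
  have h := re_inner_adjoint_self T v
  have h2 : (2⁻¹ : ℂ) = ((2⁻¹ : ℝ) : ℂ) := by norm_num
  simp only [Ts, LinearMap.smul_apply, LinearMap.add_apply, inner_smul_right, inner_add_right]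
  rw [h2, Complex.re_ofReal_mul, Complex.add_re, h]
  ring

lemma inner_Ts_left (T : G →ₗ[ℂ] G) (v w : G) : ⟪Ts T v, w⟫ = ⟪v, Ts T w⟫ := by
  simp only [Ts, LinearMap.smul_apply, LinearMap.add_apply, inner_add_left, inner_add_right,
    inner_smul_left, inner_smul_right, LinearMap.adjoint_inner_left,
    LinearMap.adjoint_inner_right, map_inv₀, map_ofNat]
  ring

lemma ringInverse_apply_apply {K V : Type*} [Semiring K] [AddCommMonoid V] [Module K V]
    {A : V →ₗ[K] V} (hA : IsUnit A) (v : V) :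
    Ring.inverse A (A v) = v :=
  LinearMap.congr_fun (Ring.inverse_mul_cancel A hA) v

lemma apply_ringInverse_apply {K V : Type*} [Semiring K] [AddCommMonoid V] [Module K V]
    {A : V →ₗ[K] V} (hA : IsUnit A) (v : V) :
    A (Ring.inverse A v) = v :=
  LinearMap.congr_fun (Ring.mul_inverse_cancel A hA) v

/-- The `Ts⁻¹`-norm is preserved by `p ↦ 2 Ts u - p` when `Re ⟪u, T u⟫ = Re ⟪u, p⟫`. -/
lemma normTsInv_two_smul_sub {T : G →ₗ[ℂ] G} (hS : IsUnit (Ts T)) {u p : G}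
    (hu : (⟪u, T u⟫).re = (⟪u, p⟫).re) :
    normTsInv T ((2 : ℂ) • Ts T u - p) = normTsInv T p := by
  obtain ⟨r, rfl⟩ : ∃ r, Ts T r = p := ⟨_, apply_ringInverse_apply hS p⟩
  have hq : (2 : ℂ) • Ts T u - Ts T r = Ts T ((2 : ℂ) • u - r) := by simp
  have hru : (⟪r, Ts T u⟫).re = (⟪u, Ts T r⟫).re := by
    rw [← inner_Ts_left, ← inner_conj_symm, Complex.conj_re]
  rw [← re_inner_Ts_self] at hu
  rw [hq, normTsInv, normTsInv, ringInverse_apply_apply hS, ringInverse_apply_apply hS,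
    inner_Ts_left, inner_Ts_left]
  congr 1
  simp only [map_sub, map_smul, inner_sub_left, inner_sub_right, inner_smul_left,
    inner_smul_right, map_ofNat, Complex.sub_re, Complex.mul_re, Complex.re_ofNat,
    Complex.im_ofNat]
  linarith

/-- Let `T` be coercive.  Then `R† T† R` is invertible and the exchange operator
`Π := (T + T†) R (R† T† R)⁻¹ R† − Id` is an isometry for the `Ts⁻¹`-norm. -/
theorem statement1
    (R : H →ₗ[ℂ] G) (hR : Function.Injective R)
    (T : G →ₗ[ℂ] G) (hT : ∀ v : G, v ≠ 0 → 0 < (⟪v, T v⟫).re) :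
    IsUnit (adjoint R ∘ₗ adjoint T ∘ₗ R) ∧
    ∀ p : G, normTsInv T (exchangeOp R T p) = normTsInv T p := by
  have hA : IsUnit (adjoint R ∘ₗ adjoint T ∘ₗ R) := by
    refine isUnit_of_re_inner_pos fun v hv => ?_
    rw [LinearMap.comp_apply, LinearMap.adjoint_inner_right, LinearMap.comp_apply,
      re_inner_adjoint_self]
    exact hT _ ((map_ne_zero_iff R hR).2 hv)
  have hS : IsUnit (Ts T) := isUnit_of_re_inner_pos fun v hv => by
    rw [re_inner_Ts_self]
    exact hT v hv
  refine ⟨hA, fun p => ?_⟩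
  set w := Ring.inverse (adjoint R ∘ₗ adjoint T ∘ₗ R) (adjoint R p) with hw
  have hAw : adjoint R (adjoint T (R w)) = adjoint R p := apply_ringInverse_apply hA _
  have h_exchange : exchangeOp R T p = (2 : ℂ) • Ts T (R w) - p := by
    simp [exchangeOp, Ts, hw, smul_smul]
  rw [h_exchange]
  refine normTsInv_two_smul_sub hS ?_
  rw [← re_inner_adjoint_self, ← LinearMap.adjoint_inner_right R, hAw,
    LinearMap.adjoint_inner_right]
end
end

section
/- Let T : G → G be coercive and self-adjoint (T = T†), so that the exchange operator is Π = 2 T R (R† T R)⁻¹ R† − Id. Then: (i) (Id − Π)/2 is a projector with range X^⊥ that is orthogonal with respect to the inner product (p, q) ↦ ⟨T⁻¹ p, q⟩, i.e. ⟨T⁻¹ ((Id − Π)/2) p, q⟩ = ⟨T⁻¹ p, ((Id − Π)/2) q⟩ for all p, q ∈ G; (ii) (Id + Π†)/2 is a projector with range X that is orthogonal with respect to the inner product (u, v) ↦ ⟨T u, v⟩; (iii) Π ∘ Π = Id; (iv) Π† ∘ R = R. -/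
open LinearMap (adjoint)
open scoped ComplexInnerProductSpace

noncomputable section

variable {G H : Type*}
  [NormedAddCommGroup G] [InnerProductSpace ℂ G] [FiniteDimensional ℂ G]
  [NormedAddCommGroup H] [InnerProductSpace ℂ H] [FiniteDimensional ℂ H]

/-- The operator `(Id − Π)/2`. -/
def projNeu (R : H →ₗ[ℂ] G) (T : G →ₗ[ℂ] G) : G →ₗ[ℂ] G :=
  (2⁻¹ : ℂ) • (LinearMap.id - exchangeOp R T)

/-- The operator `(Id + Π†)/2`. -/
def projDir (R : H →ₗ[ℂ] G) (T : G →ₗ[ℂ] G) : G →ₗ[ℂ] G :=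
  (2⁻¹ : ℂ) • (LinearMap.id + adjoint (exchangeOp R T))

/-- A coercive endomorphism of a finite-dimensional space is invertible. -/
theorem isUnit_of_coercive (T : G →ₗ[ℂ] G) (hT : ∀ v : G, v ≠ 0 → 0 < (⟪v, T v⟫).re) :
    IsUnit T := by
  rw [LinearMap.isUnit_iff_ker_eq_bot, LinearMap.ker_eq_bot']
  intro v hv
  by_contra hne
  simpa [hv] using hT v hne

/-- The compression `R† T R` of a coercive `T` along an injective `R` is invertible. -/
theorem isUnit_compression (R : H →ₗ[ℂ] G) (hR : Function.Injective R) (T : G →ₗ[ℂ] G)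
    (hT : ∀ v : G, v ≠ 0 → 0 < (⟪v, T v⟫).re) : IsUnit (adjoint R ∘ₗ T ∘ₗ R) := by
  refine isUnit_of_coercive _ fun v hv => ?_
  simpa [LinearMap.adjoint_inner_right] using hT (R v) ((map_ne_zero_iff R hR).2 hv)

/-- If `S` is self-adjoint, so is `S⁻¹`. -/
theorem adjoint_ringInverse (S : G →ₗ[ℂ] G) (hS : adjoint S = S) :
    adjoint (Ring.inverse S) = Ring.inverse S := by
  rw [← LinearMap.star_eq_adjoint] at hS ⊢
  rw [← Ring.inverse_star, hS]

/-- The operator `R (R† T R)⁻¹ R†`. -/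
def galerkinInverse (R : H →ₗ[ℂ] G) (T : G →ₗ[ℂ] G) : G →ₗ[ℂ] G :=
  R ∘ₗ Ring.inverse (adjoint R ∘ₗ T ∘ₗ R) ∘ₗ adjoint R

theorem adjoint_galerkinInverse (R : H →ₗ[ℂ] G) (T : G →ₗ[ℂ] G) (hTsa : adjoint T = T) :
    adjoint (galerkinInverse R T) = galerkinInverse R T := by
  have hS : adjoint (adjoint R ∘ₗ T ∘ₗ R) = adjoint R ∘ₗ T ∘ₗ R := by
    simp only [LinearMap.adjoint_comp, LinearMap.adjoint_adjoint, hTsa, LinearMap.comp_assoc]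
  simp only [galerkinInverse, LinearMap.adjoint_comp, LinearMap.adjoint_adjoint,
    adjoint_ringInverse _ hS, LinearMap.comp_assoc]

theorem galerkinInverse_apply_range (R : H →ₗ[ℂ] G) (hR : Function.Injective R)
    (T : G →ₗ[ℂ] G) (hT : ∀ v : G, v ≠ 0 → 0 < (⟪v, T v⟫).re) (x : H) :
    galerkinInverse R T (T (R x)) = R x :=
  congrArg R (LinearMap.congr_fun (Ring.inverse_mul_cancel _ (isUnit_compression R hR T hT)) x)

theorem adjoint_apply_galerkinInverse (R : H →ₗ[ℂ] G) (hR : Function.Injective R)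
    (T : G →ₗ[ℂ] G) (hT : ∀ v : G, v ≠ 0 → 0 < (⟪v, T v⟫).re) (p : G) :
    adjoint R (T (galerkinInverse R T p)) = adjoint R p :=
  LinearMap.congr_fun (Ring.mul_inverse_cancel _ (isUnit_compression R hR T hT)) (adjoint R p)

theorem galerkinInverse_apply_apply (R : H →ₗ[ℂ] G) (hR : Function.Injective R)
    (T : G →ₗ[ℂ] G) (hT : ∀ v : G, v ≠ 0 → 0 < (⟪v, T v⟫).re) (p : G) :
    galerkinInverse R T (T (galerkinInverse R T p)) = galerkinInverse R T p :=
  galerkinInverse_apply_range R hR T hT _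

theorem exchangeOp_apply (R : H →ₗ[ℂ] G) (T : G →ₗ[ℂ] G) (hTsa : adjoint T = T) (p : G) :
    exchangeOp R T p = (2 : ℂ) • T (galerkinInverse R T p) - p := by
  simp [exchangeOp, galerkinInverse, hTsa, two_smul]

theorem projNeu_apply (R : H →ₗ[ℂ] G) (T : G →ₗ[ℂ] G) (hTsa : adjoint T = T) (p : G) :
    projNeu R T p = p - T (galerkinInverse R T p) := by
  simp only [projNeu, LinearMap.smul_apply, LinearMap.sub_apply, LinearMap.id_apply,
    exchangeOp_apply R T hTsa]
  module

theorem adjoint_exchangeOp_apply (R : H →ₗ[ℂ] G) (T : G →ₗ[ℂ] G) (hTsa : adjoint T = T)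
    (u : G) : adjoint (exchangeOp R T) u = (2 : ℂ) • galerkinInverse R T (T u) - u := by
  refine ext_inner_right ℂ fun v => ?_
  rw [LinearMap.adjoint_inner_left, exchangeOp_apply R T hTsa, inner_sub_left, inner_sub_right,
    inner_smul_left, inner_smul_right, ← LinearMap.adjoint_inner_left, hTsa,
    ← LinearMap.adjoint_inner_left, adjoint_galerkinInverse R T hTsa,
    map_ofNat]

theorem projDir_apply (R : H →ₗ[ℂ] G) (T : G →ₗ[ℂ] G) (hTsa : adjoint T = T) (u : G) :
    projDir R T u = galerkinInverse R T (T u) := by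
  simp only [projDir, LinearMap.smul_apply, LinearMap.add_apply, LinearMap.id_apply,
    adjoint_exchangeOp_apply R T hTsa]
  module

/-- For a coercive self-adjoint `T`, with `Π = 2 T R (R† T R)⁻¹ R† − Id`:
(i) `(Id − Π)/2` is a projector onto `X^⊥`, orthogonal for the inner product
`(p, q) ↦ ⟨T⁻¹ p, q⟩`; (ii) `(Id + Π†)/2` is a projector onto `X`, orthogonal for
`(u, v) ↦ ⟨T u, v⟩`; (iii) `Π² = Id`; (iv) `Π† R = R`.
The paper's pairing `⟨a, b⟩` (linear in the first argument) is `⟪b, a⟫` in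
Mathlib's convention. -/
theorem statement2
    (R : H →ₗ[ℂ] G) (hR : Function.Injective R)
    (T : G →ₗ[ℂ] G) (hT : ∀ v : G, v ≠ 0 → 0 < (⟪v, T v⟫).re)
    (hTsa : adjoint T = T) :
    (projNeu R T ∘ₗ projNeu R T = projNeu R T ∧
      LinearMap.range (projNeu R T) = (LinearMap.range R)ᗮ ∧
      ∀ p q : G,
        ⟪q, Ring.inverse T (projNeu R T p)⟫ = ⟪projNeu R T q, Ring.inverse T p⟫) ∧
    (projDir R T ∘ₗ projDir R T = projDir R T ∧
      LinearMap.range (projDir R T) = LinearMap.range R ∧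
      ∀ u v : G, ⟪v, T (projDir R T u)⟫ = ⟪projDir R T v, T u⟫) ∧
    exchangeOp R T ∘ₗ exchangeOp R T = LinearMap.id ∧
    adjoint (exchangeOp R T) ∘ₗ R = R := by
  have hKTK := galerkinInverse_apply_apply R hR T hT
  have hKTR := galerkinInverse_apply_range R hR T hT
  have hNeu := projNeu_apply R T hTsa
  have hDir := projDir_apply R T hTsa
  have hK := adjoint_galerkinInverse R T hTsa
  have hTu := isUnit_of_coercive T hT
  have hTi : ∀ x, Ring.inverse T (T x) = x := LinearMap.congr_fun (Ring.inverse_mul_cancel T hTu)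
  have hiT : ∀ x, T (Ring.inverse T x) = x := LinearMap.congr_fun (Ring.mul_inverse_cancel T hTu)
  refine ⟨⟨?_, ?_, fun p q => ?_⟩, ⟨?_, ?_, fun u v => ?_⟩, ?_, ?_⟩
  · ext p
    simp [hNeu, hKTK]
  · rw [LinearMap.orthogonal_range]
    ext p
    rw [LinearMap.mem_range, LinearMap.mem_ker]
    constructor
    · rintro ⟨p, rfl⟩
      rw [hNeu, map_sub, adjoint_apply_galerkinInverse R hR T hT, sub_self]
    · intro hp
      exact ⟨p, by simp [hNeu, galerkinInverse, hp]⟩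
  · rw [hNeu, hNeu, map_sub, hTi, inner_sub_left, inner_sub_right,
      ← LinearMap.adjoint_inner_right T, hTsa, hiT, ← LinearMap.adjoint_inner_right, hK]
  · ext u
    simp [hDir, hKTK]
  · apply le_antisymm
    · rintro _ ⟨u, rfl⟩
      rw [hDir]
      exact LinearMap.mem_range_self R _
    · rintro _ ⟨x, rfl⟩
      exact ⟨R x, by rw [hDir, hKTR]⟩
  · rw [hDir, hDir, ← LinearMap.adjoint_inner_left T, hTsa, ← LinearMap.adjoint_inner_left, hK]
  · ext p
    simp only [LinearMap.comp_apply, LinearMap.id_apply, exchangeOp_apply R T hTsa, map_sub,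
      map_smul, hKTK]
    module
  · ext x
    rw [LinearMap.comp_apply, adjoint_exchangeOp_apply R T hTsa, hKTR]
    module
end
end

section
/- Let f ∈ V. If u ∈ X_Ω satisfies ⟨A u, v⟩ = ⟨f, v⟩ for all v ∈ X_Ω, then there exists p ∈ X^⊥ such that A u − B† p = f. Conversely, if (u, p) ∈ V × G satisfies u ∈ X_Ω, p ∈ X^⊥ and A u − B† p = f, then ⟨A u, v⟩ = ⟨f, v⟩ for all v ∈ X_Ω. -/
open LinearMap (adjoint)
open scoped ComplexInnerProductSpace

noncomputable section

variable {G H V : Type*}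
  [NormedAddCommGroup G] [InnerProductSpace ℂ G] [FiniteDimensional ℂ G]
  [NormedAddCommGroup H] [InnerProductSpace ℂ H] [FiniteDimensional ℂ H]
  [NormedAddCommGroup V] [InnerProductSpace ℂ V] [FiniteDimensional ℂ V]

/-- The orthogonal complement of a preimage is the image of the orthogonal complement
under the adjoint. -/
theorem orthogonal_comap_eq_map_adjoint (B : V →ₗ[ℂ] G) (S : Submodule ℂ G) :
    (S.comap B)ᗮ = Sᗮ.map (adjoint B) := by
  have h : (Sᗮ.map (adjoint B))ᗮ = S.comap B := by
    ext v
    rw [Submodule.mem_comap, ← S.orthogonal_orthogonal, Submodule.mem_orthogonal,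
      Submodule.mem_orthogonal]
    simp [LinearMap.adjoint_inner_left]
  rw [← h, Submodule.orthogonal_orthogonal]

/-- Equivalence between the variational problem on the conforming subspace
`X_Ω := B⁻¹(X)` and the saddle-point system `A u − B† p = f`, `p ∈ X^⊥`.
The paper's pairing `⟨a, b⟩` (linear in the first argument) is `⟪b, a⟫` in
Mathlib's convention. -/
theorem statement4
    (R : H →ₗ[ℂ] G) (hR : Function.Injective R)
    (B : V →ₗ[ℂ] G) (hB : Function.Surjective B)
    (A : V →ₗ[ℂ] V) (f : V) :
    (∀ u : V, u ∈ (LinearMap.range R).comap B →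
      (∀ v ∈ (LinearMap.range R).comap B, ⟪v, A u⟫ = ⟪v, f⟫) →
      ∃ p ∈ (LinearMap.range R)ᗮ, A u - adjoint B p = f) ∧
    (∀ u : V, ∀ p : G, u ∈ (LinearMap.range R).comap B →
      p ∈ (LinearMap.range R)ᗮ → A u - adjoint B p = f →
      ∀ v ∈ (LinearMap.range R).comap B, ⟪v, A u⟫ = ⟪v, f⟫) := by
  constructor
  · intro u _ h
    have hmem : A u - f ∈ ((LinearMap.range R).comap B)ᗮ := by
      rw [Submodule.mem_orthogonal]
      intro v hv
      rw [inner_sub_right, h v hv, sub_self]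
    rw [orthogonal_comap_eq_map_adjoint] at hmem
    obtain ⟨p, hp, hpf⟩ := hmem
    exact ⟨p, hp, by rw [hpf, sub_sub_cancel]⟩
  · rintro u p _ hp rfl v hv
    rw [inner_sub_right, LinearMap.adjoint_inner_right, hp (B v) hv, sub_zero]
end
end

section
/- Let T : G → G be coercive with exchange operator Π := (T + T†) R (R† T† R)⁻¹ R† − Id, and let f ∈ V. A pair (u, p) ∈ V × G satisfies [u ∈ X_Ω, p ∈ X^⊥, and A u − B† p = f] if and only if it satisfies [A u − B† p = f and p − i T(B u) = −Π(p + i T†(B u))]. -/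
open LinearMap (adjoint)
open scoped ComplexInnerProductSpace

noncomputable section

variable {G H V : Type*}
  [NormedAddCommGroup G] [InnerProductSpace ℂ G] [FiniteDimensional ℂ G]
  [NormedAddCommGroup H] [InnerProductSpace ℂ H] [FiniteDimensional ℂ H]
  [NormedAddCommGroup V] [InnerProductSpace ℂ V] [FiniteDimensional ℂ V]

/-- The symmetric part `T + T†` of a coercive operator is injective. -/
theorem eq_zero_of_add_adjoint_apply_eq_zero {T : G →ₗ[ℂ] G}
    (hT : ∀ v : G, v ≠ 0 → 0 < (⟪v, T v⟫).re) {v : G} (hv : (T + adjoint T) v = 0) :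
    v = 0 := by
  by_contra hne
  have hpos := hT v hne
  have hzero : (⟪v, (T + adjoint T) v⟫).re = 0 := by rw [hv, inner_zero_right, Complex.zero_re]
  have hsymm : (⟪v, adjoint T v⟫).re = (⟪v, T v⟫).re := by
    rw [LinearMap.adjoint_inner_right]
    exact inner_re_symm (𝕜 := ℂ) (T v) v
  rw [LinearMap.add_apply, inner_add_right, Complex.add_re, hsymm] at hzero
  linarith

/-- For coercive `T` and injective `R`, the operator `R† T† R` is invertible. -/
theorem isUnit_adjoint_comp_adjoint_comp {R : H →ₗ[ℂ] G} (hR : Function.Injective R)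
    {T : G →ₗ[ℂ] G} (hT : ∀ v : G, v ≠ 0 → 0 < (⟪v, T v⟫).re) :
    IsUnit (adjoint R ∘ₗ adjoint T ∘ₗ R) := by
  rw [LinearMap.isUnit_iff_ker_eq_bot, LinearMap.ker_eq_bot']
  intro h hh
  by_contra hne
  have hpos := hT (R h) ((map_ne_zero_iff R hR).2 hne)
  have hzero : ⟪(adjoint R ∘ₗ adjoint T ∘ₗ R) h, h⟫ = 0 := by rw [hh, inner_zero_left]
  rw [LinearMap.comp_apply, LinearMap.comp_apply, LinearMap.adjoint_inner_left,
    LinearMap.adjoint_inner_left] at hzero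
  rw [hzero, Complex.zero_re] at hpos
  exact lt_irrefl 0 hpos

/-- The orthogonal complement of the range of `R` is the kernel of `R†`. -/
theorem mem_range_orthogonal_iff (R : H →ₗ[ℂ] G) (p : G) :
    p ∈ (LinearMap.range R)ᗮ ↔ adjoint R p = 0 := by
  rw [LinearMap.orthogonal_range, LinearMap.mem_ker]

/-- For coercive `T`, the transmission condition `p − i T w = −Π(p + i T† w)` says that
`i w` is `R (R† T† R)⁻¹ R†` applied to `p + i T† w`. -/
theorem sub_eq_neg_exchangeOp_iff (R : H →ₗ[ℂ] G) {T : G →ₗ[ℂ] G}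
    (hT : ∀ v : G, v ≠ 0 → 0 < (⟪v, T v⟫).re) (w p : G) :
    p - Complex.I • T w = -exchangeOp R T (p + Complex.I • adjoint T w) ↔
      Complex.I • w = R (Ring.inverse (adjoint R ∘ₗ adjoint T ∘ₗ R)
        (adjoint R (p + Complex.I • adjoint T w))) := by
  simp only [exchangeOp, LinearMap.sub_apply, LinearMap.comp_apply, LinearMap.id_apply]
  generalize R _ = z
  have hdiff : p - Complex.I • T w - -((T + adjoint T) z - (p + Complex.I • adjoint T w))
      = -(T + adjoint T) (Complex.I • w - z) := by
    simp only [map_sub, map_smul, LinearMap.add_apply]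
    module
  rw [← sub_eq_zero, hdiff, neg_eq_zero, ← sub_eq_zero (a := Complex.I • w)]
  exact ⟨eq_zero_of_add_adjoint_apply_eq_zero hT, fun h => by rw [h, map_zero]⟩

/-- For coercive `T`, a pair `(u, p)` satisfies `u ∈ X_Ω`, `p ∈ X^⊥` and
`A u − B† p = f` if and only if it satisfies `A u − B† p = f` together with the
impedance transmission condition `p − i T (B u) = −Π(p + i T† (B u))`. -/
theorem statement5
    (R : H →ₗ[ℂ] G) (hR : Function.Injective R)
    (B : V →ₗ[ℂ] G) (hB : Function.Surjective B)
    (A : V →ₗ[ℂ] V)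
    (T : G →ₗ[ℂ] G) (hT : ∀ v : G, v ≠ 0 → 0 < (⟪v, T v⟫).re)
    (f : V) (u : V) (p : G) :
    (u ∈ (LinearMap.range R).comap B ∧ p ∈ (LinearMap.range R)ᗮ ∧
        A u - adjoint B p = f) ↔
      (A u - adjoint B p = f ∧
        p - Complex.I • T (B u)
          = -exchangeOp R T (p + Complex.I • adjoint T (B u))) := by
  rw [sub_eq_neg_exchangeOp_iff R hT, mem_range_orthogonal_iff, Submodule.mem_comap]
  generalize B u = w
  have hL := isUnit_adjoint_comp_adjoint_comp hR hT
  set L : Module.End ℂ H := adjoint R ∘ₗ adjoint T ∘ₗ R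
  have hL_apply (h : H) : L h = adjoint R (adjoint T (R h)) := rfl
  constructor
  · rintro ⟨⟨h, rfl⟩, hp, hf⟩
    refine ⟨hf, ?_⟩
    rw [map_add, hp, zero_add, map_smul, ← hL_apply, map_smul, ← Module.End.mul_apply,
      Ring.inverse_mul_cancel L hL, Module.End.one_apply, map_smul]
  · rintro ⟨hf, hw⟩
    refine ⟨?_, ?_, hf⟩
    · exact ((LinearMap.range R).smul_mem_iff Complex.I_ne_zero).1 ⟨_, hw.symm⟩
    · have hcancel := congrArg (fun x => adjoint R (adjoint T x)) hw
      simp only [← hL_apply] at hcancel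
      rw [← Module.End.mul_apply, Ring.mul_inverse_cancel L hL, Module.End.one_apply,
        map_add, map_smul, map_smul] at hcancel
      exact right_eq_add.1 hcancel
end
end

section
/- Let T : G → G be coercive and let 𝒞 := {(v, p) ∈ G × G : there exists u ∈ V with A u = B† p and B u = v}. If (v, p) ∈ 𝒞, then Im⟨p, v⟩ ≤ 0 and one has the energy identities ‖v‖²_{Ts} + ‖p‖²_{Ts⁻¹} = ‖p + i Ts v‖²_{Ts⁻¹} + 2 |Im⟨p, v⟩| = ‖p − i Ts v‖²_{Ts⁻¹} − 2 |Im⟨p, v⟩|. -/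
open LinearMap (adjoint)
open scoped ComplexInnerProductSpace

noncomputable section

variable {G V : Type*}
  [NormedAddCommGroup G] [InnerProductSpace ℂ G] [FiniteDimensional ℂ G]
  [NormedAddCommGroup V] [InnerProductSpace ℂ V] [FiniteDimensional ℂ V]

/-- The norm `‖v‖_{Ts}`, i.e. `√⟨Ts v, v⟩` with the paper's pairing,
which reads `√⟪v, Ts v⟫` in Mathlib's convention. -/
def normTsN (T : G →ₗ[ℂ] G) (v : G) : ℝ :=
  Real.sqrt (⟪v, Ts T v⟫).re

theorem Ts_isSymmetric (T : G →ₗ[ℂ] G) : (Ts T).IsSymmetric := by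
  intro x y
  simp only [Ts, LinearMap.smul_apply, LinearMap.add_apply, inner_smul_left, inner_smul_right,
    inner_add_left, inner_add_right, LinearMap.adjoint_inner_left, LinearMap.adjoint_inner_right]
  rw [map_inv₀, Complex.conj_ofNat, add_comm]

theorem re_inner_Ts (T : G →ₗ[ℂ] G) (x : G) : (⟪x, Ts T x⟫).re = (⟪x, T x⟫).re := by
  have h : (⟪T x, x⟫).re = (⟪x, T x⟫).re := inner_re_symm (𝕜 := ℂ) (T x) x
  have h2 : (2⁻¹ : ℂ) = ((2⁻¹ : ℝ) : ℂ) := by push_cast; rfl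
  simp only [Ts, LinearMap.smul_apply, LinearMap.add_apply, inner_smul_right,
    inner_add_right, LinearMap.adjoint_inner_right]
  rw [h2, Complex.re_ofReal_mul, Complex.add_re, h]
  ring

theorem re_inner_Ts_nonneg {T : G →ₗ[ℂ] G} (hT : ∀ v : G, v ≠ 0 → 0 < (⟪v, T v⟫).re)
    (x : G) : 0 ≤ (⟪x, Ts T x⟫).re := by
  rw [re_inner_Ts]
  rcases eq_or_ne x 0 with rfl | hx
  · simp
  · exact (hT x hx).le

theorem isUnit_Ts {T : G →ₗ[ℂ] G} (hT : ∀ v : G, v ≠ 0 → 0 < (⟪v, T v⟫).re) :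
    IsUnit (Ts T) := by
  rw [LinearMap.isUnit_iff_ker_eq_bot, LinearMap.ker_eq_bot']
  intro x hx
  by_contra h0
  have h := hT x h0
  rw [← re_inner_Ts, hx, inner_zero_right] at h
  exact lt_irrefl _ h

theorem normTsN_sq {T : G →ₗ[ℂ] G} (hT : ∀ v : G, v ≠ 0 → 0 < (⟪v, T v⟫).re)
    (x : G) : normTsN T x ^ 2 = (⟪x, Ts T x⟫).re :=
  Real.sq_sqrt (re_inner_Ts_nonneg hT x)

theorem normTsInv_Ts_sq {T : G →ₗ[ℂ] G} (hT : ∀ v : G, v ≠ 0 → 0 < (⟪v, T v⟫).re)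
    (x : G) : normTsInv T (Ts T x) ^ 2 = (⟪x, Ts T x⟫).re := by
  have h : Ring.inverse (Ts T) (Ts T x) = x :=
    LinearMap.congr_fun (Ring.inverse_mul_cancel _ (isUnit_Ts hT)) x
  rw [normTsInv, h, Ts_isSymmetric T x x, Real.sq_sqrt (re_inner_Ts_nonneg hT x)]

/-- Expansion of the energy of `q + i v` with respect to the symmetric part of `T`. -/
theorem re_inner_Ts_add_smul_I (T : G →ₗ[ℂ] G) (q v : G) :
    (⟪q + Complex.I • v, Ts T (q + Complex.I • v)⟫).re
      = (⟪q, Ts T q⟫).re + (⟪v, Ts T v⟫).re + 2 * (⟪v, Ts T q⟫).im := by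
  have h : (⟪q, Ts T v⟫).im = -(⟪v, Ts T q⟫).im := by
    rw [← Ts_isSymmetric T q v]
    exact inner_im_symm (𝕜 := ℂ) (Ts T q) v
  simp only [map_add, map_smul, inner_add_left, inner_add_right, inner_smul_left,
    inner_smul_right, Complex.conj_I, Complex.add_re, Complex.add_im, Complex.mul_re, Complex.mul_im,
    Complex.neg_re, Complex.neg_im, Complex.I_re, Complex.I_im, h]
  ring

/-- If `(v, p)` is a discrete Cauchy datum then `Im⟨p, v⟩ ≤ 0` and the two energy
identities hold.  The paper's pairing `⟨p, v⟩` (linear in the first argument) is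
`⟪v, p⟫` in Mathlib's convention. -/
theorem statement9
    (B : V →ₗ[ℂ] G) (hB : Function.Surjective B)
    (A : V →ₗ[ℂ] V)
    (hAim : ∀ u : V, (⟪u, A u⟫).im ≤ 0)
    (T : G →ₗ[ℂ] G) (hT : ∀ v : G, v ≠ 0 → 0 < (⟪v, T v⟫).re)
    (v p : G) (hvp : ∃ u : V, A u = adjoint B p ∧ B u = v) :
    (⟪v, p⟫).im ≤ 0 ∧
    (normTsN T v) ^ 2 + (normTsInv T p) ^ 2
      = (normTsInv T (p + Complex.I • Ts T v)) ^ 2 + 2 * |(⟪v, p⟫).im| ∧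
    (normTsN T v) ^ 2 + (normTsInv T p) ^ 2
      = (normTsInv T (p - Complex.I • Ts T v)) ^ 2 - 2 * |(⟪v, p⟫).im| := by
  obtain ⟨u, hu, rfl⟩ := hvp
  have him : (⟪B u, p⟫).im ≤ 0 := by
    rw [← LinearMap.adjoint_inner_right, ← hu]
    exact hAim u
  obtain ⟨q, rfl⟩ : ∃ q, Ts T q = p :=
    ((Module.End.isUnit_iff _).1 (isUnit_Ts hT)).2 p
  have hplus := re_inner_Ts_add_smul_I T q (B u)
  have hminus := re_inner_Ts_add_smul_I T q (-B u)
  simp only [smul_neg, map_neg, inner_neg_left, inner_neg_right, neg_neg, Complex.neg_im,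
    ← sub_eq_add_neg] at hminus
  rw [← map_smul, ← map_add, ← map_sub, normTsN_sq hT, normTsInv_Ts_sq hT, normTsInv_Ts_sq hT,
    normTsInv_Ts_sq hT, abs_of_nonpos him, hplus, hminus]
  exact ⟨him, by ring, by ring⟩
end
end

section
/- Let D : G → G be a positive definite self-adjoint (HPD) operator and set Π_loc := 2 D R (R† D R)⁻¹ R† − Id. Then for any coercive operator T : G → G one has the equivalence: Π_loc ∘ T† ∘ R = T ∘ R if and only if Π_loc = (T + T†) R (R† T† R)⁻¹ R† − Id. -/
open LinearMap (adjoint)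
open scoped ComplexInnerProductSpace

noncomputable section

variable {G H : Type*}
  [NormedAddCommGroup G] [InnerProductSpace ℂ G] [FiniteDimensional ℂ G]
  [NormedAddCommGroup H] [InnerProductSpace ℂ H] [FiniteDimensional ℂ H]

/-- The local swapping operator `Π_loc := 2 D R (R† D R)⁻¹ R† − Id`
associated to an HPD operator `D`. -/
def piLoc (R : H →ₗ[ℂ] G) (D : G →ₗ[ℂ] G) : G →ₗ[ℂ] G :=
  (2 : ℂ) • (D ∘ₗ R ∘ₗ Ring.inverse (adjoint R ∘ₗ D ∘ₗ R) ∘ₗ adjoint R)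
    - LinearMap.id

/-- The compression of the adjoint of a coercive operator along an injective map is invertible. -/
theorem isUnit_compression_adjoint_of_coercive
    (R : H →ₗ[ℂ] G) (hR : Function.Injective R)
    (T : G →ₗ[ℂ] G) (hT : ∀ v : G, v ≠ 0 → 0 < (⟪v, T v⟫).re) :
    IsUnit (adjoint R ∘ₗ adjoint T ∘ₗ R) := by
  rw [LinearMap.isUnit_iff_ker_eq_bot, LinearMap.ker_eq_bot']
  intro x hx
  by_contra hne
  have hRx : R x ≠ 0 := fun h => hne (hR (by rw [h, map_zero]))
  have hpos := hT (R x) hRx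
  have hzero : ⟪T (R x), R x⟫ = 0 := by
    rw [← LinearMap.adjoint_inner_right, ← inner_conj_symm, ← LinearMap.adjoint_inner_left]
    simp only [LinearMap.comp_apply] at hx
    simp [hx]
  rw [← inner_conj_symm, hzero] at hpos
  simp at hpos

/-- For HPD `D` and coercive `T`, one has `Π_loc T† R = T R` if and only if
`Π_loc` is the exchange operator associated to `T`. -/
theorem statement17
    (R : H →ₗ[ℂ] G) (hR : Function.Injective R)
    (D : G →ₗ[ℂ] G) (hDsa : adjoint D = D)
    (hDpos : ∀ v : G, v ≠ 0 → 0 < (⟪v, D v⟫).re)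
    (T : G →ₗ[ℂ] G) (hT : ∀ v : G, v ≠ 0 → 0 < (⟪v, T v⟫).re) :
    piLoc R D ∘ₗ adjoint T ∘ₗ R = T ∘ₗ R ↔ piLoc R D = exchangeOp R T := by
  have hA := isUnit_compression_adjoint_of_coercive R hR T hT
  have hmul := Ring.mul_inverse_cancel _ hA
  have hinv := Ring.inverse_mul_cancel _ hA
  constructor
  · intro h
    ext g
    have hg := LinearMap.congr_fun h
      (Ring.inverse (adjoint R ∘ₗ adjoint T ∘ₗ R) (adjoint R g))
    have hcancel := LinearMap.congr_fun hmul (adjoint R g)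
    simp only [Module.End.mul_apply, Module.End.one_apply, LinearMap.comp_apply] at hcancel
    simp only [piLoc, exchangeOp, LinearMap.comp_apply, LinearMap.sub_apply,
      LinearMap.smul_apply, LinearMap.id_apply, LinearMap.add_apply] at hg ⊢
    rw [hcancel] at hg
    rw [← hg, sub_add_cancel]
  · intro h
    ext x
    have hcancel := LinearMap.congr_fun hinv x
    simp only [Module.End.mul_apply, Module.End.one_apply, LinearMap.comp_apply] at hcancel
    rw [h]
    simp only [exchangeOp, LinearMap.comp_apply, LinearMap.sub_apply,
      LinearMap.id_apply, LinearMap.add_apply]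
    rw [hcancel, add_sub_cancel_right]
end
end

section
/- Let D : G → G be a positive definite self-adjoint (HPD) operator and set Π_loc := 2 D R (R† D R)⁻¹ R† − Id. Then for any coercive operator T : G → G: if Π_loc ∘ T = T† ∘ Π_loc†, then Π_loc = (T + T†) R (R† T† R)⁻¹ R† − Id. -/
open LinearMap (adjoint)
open scoped ComplexInnerProductSpace

noncomputable section

variable {G H : Type*}
  [NormedAddCommGroup G] [InnerProductSpace ℂ G] [FiniteDimensional ℂ G]
  [NormedAddCommGroup H] [InnerProductSpace ℂ H] [FiniteDimensional ℂ H]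

/-- The compression of a coercive operator along an injective map is invertible. -/
theorem isUnit_compression_of_coercive (R : H →ₗ[ℂ] G) (hR : Function.Injective R)
    (T : G →ₗ[ℂ] G) (hT : ∀ v : G, v ≠ 0 → 0 < (⟪v, T v⟫).re) :
    IsUnit (M := H →ₗ[ℂ] H) (adjoint R ∘ₗ T ∘ₗ R) := by
  rw [LinearMap.isUnit_iff_ker_eq_bot, LinearMap.ker_eq_bot']
  intro x hx
  by_contra hne
  have hpos := hT (R x) fun h => hne (hR (h.trans (map_zero R).symm))
  rw [← LinearMap.adjoint_inner_right R] at hpos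
  simp only [LinearMap.comp_apply] at hx
  simp [hx] at hpos

theorem inner_adjoint_re_pos (T : G →ₗ[ℂ] G)
    (hT : ∀ v : G, v ≠ 0 → 0 < (⟪v, T v⟫).re) (v : G) (hv : v ≠ 0) :
    0 < (⟪v, adjoint T v⟫).re := by
  rw [LinearMap.adjoint_inner_right, ← inner_conj_symm, Complex.conj_re]
  exact hT v hv

/-- For HPD `D` and coercive `T`: if `Π_loc T = T† Π_loc†`, then `Π_loc` is the
exchange operator associated to `T`. -/
theorem statement18
    (R : H →ₗ[ℂ] G) (hR : Function.Injective R)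
    (D : G →ₗ[ℂ] G) (hDsa : adjoint D = D)
    (hDpos : ∀ v : G, v ≠ 0 → 0 < (⟪v, D v⟫).re)
    (T : G →ₗ[ℂ] G) (hT : ∀ v : G, v ≠ 0 → 0 < (⟪v, T v⟫).re)
    (hcomm : piLoc R D ∘ₗ T = adjoint T ∘ₗ adjoint (piLoc R D)) :
    piLoc R D = exchangeOp R T := by
  have hK := isUnit_compression_of_coercive R hR D hDpos
  have hM := isUnit_compression_of_coercive R hR (adjoint T) (inner_adjoint_re_pos T hT)
  have hKsa : adjoint (adjoint R ∘ₗ D ∘ₗ R) = adjoint R ∘ₗ D ∘ₗ R := by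
    simp [LinearMap.adjoint_comp, hDsa, LinearMap.comp_assoc]
  have hKr := Ring.mul_inverse_cancel _ hK
  have hMr := Ring.mul_inverse_cancel _ hM
  unfold piLoc at hcomm
  unfold piLoc exchangeOp
  generalize Ring.inverse (adjoint R ∘ₗ D ∘ₗ R) = K at *
  generalize Ring.inverse (adjoint R ∘ₗ adjoint T ∘ₗ R) = M at *
  have hKadj : adjoint K ∘ₗ (adjoint R ∘ₗ D ∘ₗ R) = LinearMap.id := by
    rw [← hKsa, ← LinearMap.adjoint_comp]
    exact (congrArg adjoint hKr).trans LinearMap.adjoint_id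
  have hKadj' (x : H) : adjoint K (adjoint R (D (R x))) = x := LinearMap.congr_fun hKadj x
  have hKr' (x : H) : adjoint R (D (R (K x))) = x := LinearMap.congr_fun hKr x
  have hMr' (x : H) : adjoint R (adjoint T (R (M x))) = x := LinearMap.congr_fun hMr x
  have hTR (x : H) :
      (2 : ℂ) • D (R (K (adjoint R (T (R x))))) = T (R x) + adjoint T (R x) := by
    have h := LinearMap.congr_fun hcomm (R x)
    simp only [map_sub, map_smulₛₗ, LinearMap.adjoint_comp, LinearMap.adjoint_adjoint, hDsa,
      LinearMap.adjoint_id, LinearMap.comp_apply, LinearMap.sub_apply, LinearMap.smul_apply,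
      LinearMap.id_apply, hKadj', map_ofNat] at h
    rw [sub_eq_iff_eq_add.mp h, two_smul]
    abel
  have hRTR (x : H) : adjoint R (T (R x)) = adjoint R (adjoint T (R x)) := by
    have h := congrArg (adjoint R) (hTR x)
    rw [map_smul, hKr', map_add, two_smul] at h
    exact add_left_cancel h
  ext x
  simp only [LinearMap.sub_apply, LinearMap.smul_apply, LinearMap.comp_apply,
    LinearMap.add_apply, ← hTR, hRTR, hMr']
end
end

section
/- Let D : G → G be a positive definite self-adjoint (HPD) operator and set Π_loc := 2 D R (R† D R)⁻¹ R† − Id. Then for any coercive operator T : G → G that is in addition self-adjoint (T = T†), one has the equivalence: Π_loc ∘ T = T ∘ Π_loc† if and only if Π_loc = 2 T R (R† T R)⁻¹ R† − Id. -/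
open LinearMap (adjoint)
open scoped ComplexInnerProductSpace

noncomputable section

variable {G H : Type*}
  [NormedAddCommGroup G] [InnerProductSpace ℂ G] [FiniteDimensional ℂ G]
  [NormedAddCommGroup H] [InnerProductSpace ℂ H] [FiniteDimensional ℂ H]

theorem isUnit_adjoint_comp_comp (R : H →ₗ[ℂ] G) (hR : Function.Injective R)
    (T : G →ₗ[ℂ] G) (hT : ∀ v : G, v ≠ 0 → 0 < (⟪v, T v⟫).re) :
    IsUnit (M := Module.End ℂ H) (adjoint R ∘ₗ T ∘ₗ R) := by
  rw [LinearMap.isUnit_iff_ker_eq_bot, LinearMap.ker_eq_bot']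
  intro v hv
  by_contra hne
  have hpos := hT (R v) fun h => hne (hR (h.trans (map_zero R).symm))
  rw [← LinearMap.adjoint_inner_right] at hpos
  simp only [LinearMap.comp_apply] at hv
  simp [hv] at hpos

theorem adjoint_ringInverse_s19 (A : Module.End ℂ H) (hA : adjoint A = A) :
    adjoint (Ring.inverse A) = Ring.inverse A := by
  rw [← LinearMap.star_eq_adjoint] at hA ⊢
  rw [← Ring.inverse_star, hA]

theorem adjoint_piLoc (R : H →ₗ[ℂ] G) (T : G →ₗ[ℂ] G) (hTsa : adjoint T = T) :
    adjoint (piLoc R T) =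
      (2 : ℂ) • (R ∘ₗ Ring.inverse (adjoint R ∘ₗ T ∘ₗ R) ∘ₗ adjoint R ∘ₗ T)
        - LinearMap.id := by
  have hS : adjoint (Ring.inverse (adjoint R ∘ₗ T ∘ₗ R)) =
      Ring.inverse (adjoint R ∘ₗ T ∘ₗ R) :=
    adjoint_ringInverse_s19 _ (by
      simp only [LinearMap.adjoint_comp, LinearMap.adjoint_adjoint, hTsa, LinearMap.comp_assoc])
  simp only [piLoc, map_sub, map_smulₛₗ, LinearMap.adjoint_comp, LinearMap.adjoint_adjoint, hTsa,
    hS, LinearMap.adjoint_id, LinearMap.comp_assoc, map_ofNat]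

theorem piLoc_comp_eq_comp_adjoint_iff (R : H →ₗ[ℂ] G) (D T : G →ₗ[ℂ] G)
    (hDsa : adjoint D = D) :
    piLoc R D ∘ₗ T = T ∘ₗ adjoint (piLoc R D) ↔
      D ∘ₗ R ∘ₗ Ring.inverse (adjoint R ∘ₗ D ∘ₗ R) ∘ₗ adjoint R ∘ₗ T =
        T ∘ₗ R ∘ₗ Ring.inverse (adjoint R ∘ₗ D ∘ₗ R) ∘ₗ adjoint R ∘ₗ D := by
  rw [adjoint_piLoc R D hDsa, piLoc, LinearMap.sub_comp, LinearMap.comp_sub,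
    LinearMap.smul_comp, LinearMap.comp_smul, LinearMap.id_comp, LinearMap.comp_id,
    sub_left_inj, smul_right_inj (two_ne_zero : (2 : ℂ) ≠ 0)]
  simp only [LinearMap.comp_assoc]

/-- For HPD `D` and coercive self-adjoint `T`, one has `Π_loc T = T Π_loc†`
if and only if `Π_loc = 2 T R (R† T R)⁻¹ R† − Id`. -/
theorem statement19
    (R : H →ₗ[ℂ] G) (hR : Function.Injective R)
    (D : G →ₗ[ℂ] G) (hDsa : adjoint D = D)
    (hDpos : ∀ v : G, v ≠ 0 → 0 < (⟪v, D v⟫).re)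
    (T : G →ₗ[ℂ] G) (hT : ∀ v : G, v ≠ 0 → 0 < (⟪v, T v⟫).re)
    (hTsa : adjoint T = T) :
    piLoc R D ∘ₗ T = T ∘ₗ adjoint (piLoc R D) ↔ piLoc R D = piLoc R T := by
  have hD := isUnit_adjoint_comp_comp R hR D hDpos
  have hTu := isUnit_adjoint_comp_comp R hR T hT
  constructor
  · rw [piLoc_comp_eq_comp_adjoint_iff R D T hDsa]
    intro h
    have hSD : Ring.inverse (adjoint R ∘ₗ D ∘ₗ R) ∘ₗ (adjoint R ∘ₗ D ∘ₗ R) = LinearMap.id :=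
      Ring.inverse_mul_cancel _ hD
    have hST : (adjoint R ∘ₗ T ∘ₗ R) ∘ₗ Ring.inverse (adjoint R ∘ₗ T ∘ₗ R) = LinearMap.id :=
      Ring.mul_inverse_cancel _ hTu
    have hTR : (D ∘ₗ R ∘ₗ Ring.inverse (adjoint R ∘ₗ D ∘ₗ R)) ∘ₗ (adjoint R ∘ₗ T ∘ₗ R) =
        T ∘ₗ R := by
      have h' := congrArg (· ∘ₗ R) h
      simp only [LinearMap.comp_assoc] at h' ⊢
      rw [h', hSD, LinearMap.comp_id]
    have hDS : D ∘ₗ R ∘ₗ Ring.inverse (adjoint R ∘ₗ D ∘ₗ R) =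
        (T ∘ₗ R) ∘ₗ Ring.inverse (adjoint R ∘ₗ T ∘ₗ R) := by
      have h' := congrArg (· ∘ₗ Ring.inverse (adjoint R ∘ₗ T ∘ₗ R)) hTR
      rwa [LinearMap.comp_assoc _ (adjoint R ∘ₗ T ∘ₗ R), hST, LinearMap.comp_id] at h'
    have hP := congrArg (· ∘ₗ adjoint R) hDS
    simp only [LinearMap.comp_assoc] at hP
    rw [piLoc, piLoc, hP]
  · intro h
    rw [h, piLoc_comp_eq_comp_adjoint_iff R T T hTsa]
end
end
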